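/- arXiv:1910.13763 — 2 statements merged into one kernel-verified Lean document; each statement's English description precedes it below -/
import Mathlib

section
/- Let ℓ ≥ 2 be an integer. For every integer i with 0 ≤ i ≤ ⌊√(2^{ℓ+2} − 1)⌋ (equivalently, i^2 < 2^{ℓ+2}), one has s_1((i + 2^{ℓ+1})^2) ≡ s_1(i^2) + s_1(i) + 1 (mod 2) and s_1((i + 2^{ℓ+2})^2) ≡ s_1(i^2) + s_1(i) + 1 (mod 2); consequently t_{(i+2^{ℓ+1})^2} = t_{(i+2^{ℓ+2})^2}. -/
/-- `patternCount k n` is the number of indices `i ≥ 0` such that the binary digits of `n`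
in positions `i, i+1, …, i+k-1` are all equal to `1`. For `k = 1` this is the binary
digit sum `s₁(n)`. -/
noncomputable def patternCount (k n : ℕ) : ℕ := {i : ℕ | ∀ j < k, n.testBit (i + j)}.ncard

/-- The Thue–Morse sequence over `F₂`: `t n ≡ s₁(n) (mod 2)`. -/
noncomputable def thueMorse (n : ℕ) : ZMod 2 := (patternCount 1 n : ZMod 2)

/-- The pattern sequence `P_k` over `F₂`: `p n ≡ s_k(n) (mod 2)`. -/
noncomputable def patternSeq (k n : ℕ) : ZMod 2 := (patternCount k n : ZMod 2)

theorem patternCount_one_eq_ncard (n : ℕ) : patternCount 1 n = {i : ℕ | n.testBit i}.ncard := by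
  simp [patternCount]

theorem finite_setOf_testBit (n : ℕ) : {i : ℕ | n.testBit i}.Finite := by
  refine (Set.finite_lt_nat n).subset fun i hi => ?_
  exact Nat.lt_two_pow_self.trans_le (Nat.ge_two_pow_of_testBit hi)

/-- The binary digit sum is additive over blocks of digits that do not overlap. -/
theorem patternCount_one_two_pow_mul_add {a k : ℕ} (b : ℕ) (ha : a < 2 ^ k) :
    patternCount 1 (2 ^ k * b + a) = patternCount 1 a + patternCount 1 b := by
  simp only [patternCount_one_eq_ncard]
  have hlt {i : ℕ} (hi : a.testBit i) : i < k :=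
    (Nat.pow_lt_pow_iff_right one_lt_two).1 ((Nat.ge_two_pow_of_testBit hi).trans_lt ha)
  have hset : {i : ℕ | (2 ^ k * b + a).testBit i} =
      {i | a.testBit i} ∪ (k + ·) '' {i | b.testBit i} := by
    ext i
    simp only [Set.mem_ofPred_eq, Set.mem_union, Set.mem_image, Nat.testBit_two_pow_mul_add b ha]
    split_ifs with h
    · exact ⟨Or.inl, fun H => H.elim id fun ⟨j, _, hj⟩ => by omega⟩
    · refine ⟨fun H => Or.inr ⟨i - k, H, by omega⟩, ?_⟩
      rintro (H | ⟨j, hj, rfl⟩)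
      · exact absurd (hlt H) h
      · simpa using hj
  have hdisj : Disjoint {i : ℕ | a.testBit i} ((k + ·) '' {i : ℕ | b.testBit i}) := by
    rw [Set.disjoint_left]
    rintro _ hi ⟨j, _, rfl⟩
    have : k + j < k := hlt hi
    omega
  rw [hset, Set.ncard_union_eq hdisj (finite_setOf_testBit a) ((finite_setOf_testBit b).image _),
    Set.ncard_image_of_injective _ (add_right_injective k)]

theorem patternCount_one_one : patternCount 1 1 = 1 := by
  have : {i : ℕ | Nat.testBit 1 i} = {0} := by
    ext i
    simp [Nat.testBit_one_eq_true_iff_self_eq_zero]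
  rw [patternCount_one_eq_ncard, this, Set.ncard_singleton]

theorem patternCount_one_sq_add_two_pow {i m : ℕ} (hi : i < 2 ^ m) (hsq : i ^ 2 < 2 ^ (m + 2)) :
    patternCount 1 ((i + 2 ^ (m + 1)) ^ 2) = patternCount 1 (i ^ 2) + patternCount 1 i + 1 := by
  have h : (i + 2 ^ (m + 1)) ^ 2 = 2 ^ (m + 2) * (2 ^ m * 1 + i) + i ^ 2 := by ring
  rw [h, patternCount_one_two_pow_mul_add _ hsq, patternCount_one_two_pow_mul_add _ hi,
    patternCount_one_one, add_assoc]

theorem thueMorse_squares_shift_eq (ℓ : ℕ) (hℓ : 2 ≤ ℓ)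
    (i : ℕ) (hi : i ^ 2 < 2 ^ (ℓ + 2)) :
    ((patternCount 1 ((i + 2 ^ (ℓ + 1)) ^ 2) : ZMod 2)
        = (patternCount 1 (i ^ 2) : ZMod 2) + (patternCount 1 i : ZMod 2) + 1) ∧
    ((patternCount 1 ((i + 2 ^ (ℓ + 2)) ^ 2) : ZMod 2)
        = (patternCount 1 (i ^ 2) : ZMod 2) + (patternCount 1 i : ZMod 2) + 1) ∧
    thueMorse ((i + 2 ^ (ℓ + 1)) ^ 2) = thueMorse ((i + 2 ^ (ℓ + 2)) ^ 2) := by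
  have hlt : i < 2 ^ ℓ := by
    refine lt_of_pow_lt_pow_left₀ 2 (Nat.zero_le _) (hi.trans_le ?_)
    rw [← pow_mul]
    exact Nat.pow_le_pow_right two_pos (by omega)
  have h₁ := patternCount_one_sq_add_two_pow hlt hi
  have h₂ := patternCount_one_sq_add_two_pow (m := ℓ + 1)
    (hlt.trans (Nat.pow_lt_pow_right one_lt_two (by omega)))
    (hi.trans (Nat.pow_lt_pow_right one_lt_two (by omega)))
  refine ⟨?_, ?_, ?_⟩
  · rw [h₁]
    push_cast
    rfl
  · rw [h₂]
    push_cast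
    rfl
  · rw [thueMorse, thueMorse, h₁, h₂]
end

section
/- Let k ≥ 2 and ℓ ≥ 1 be integers. For every integer i with 0 ≤ i ≤ ⌊√(2^{ℓ+2k−1} − 1)⌋ (equivalently, i^2 < 2^{ℓ+2k−1}), one has s_k((i + 2^{ℓ+2k−1})^2) = s_k(i^2) + s_k(i) and s_k((i + 2^{ℓ+2k})^2) = s_k(i^2) + s_k(i); consequently p_{(i+2^{ℓ+2k−1})^2} = p_{(i+2^{ℓ+2k})^2}. -/
theorem finite_setOf_pattern {k : ℕ} (hk : 0 < k) (n : ℕ) :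
    {i : ℕ | ∀ j < k, n.testBit (i + j)}.Finite := by
  refine (Set.finite_lt_nat n).subset fun i hi => ?_
  have h : n.testBit i := hi 0 hk
  exact Nat.lt_two_pow_self.trans_le (Nat.ge_two_pow_of_testBit h)

/-- Two binary words separated by a zero digit contribute independently to the pattern count. -/
theorem patternCount_add_two_pow_mul {k : ℕ} (hk : 0 < k) {a m : ℕ} (ha : a < 2 ^ m) (b : ℕ) :
    patternCount k (a + 2 ^ (m + 1) * b) = patternCount k a + patternCount k b := by
  have hbit (j : ℕ) : (a + 2 ^ (m + 1) * b).testBit j =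
      if j < m + 1 then a.testBit j else b.testBit (j - (m + 1)) := by
    rw [add_comm, Nat.testBit_two_pow_mul_add b
      (ha.trans (Nat.pow_lt_pow_right one_lt_two m.lt_succ_self))]
  have hzero (j : ℕ) (hj : m ≤ j) : a.testBit j = false :=
    Nat.testBit_lt_two_pow (ha.trans_le (Nat.pow_le_pow_right two_pos hj))
  have hunion : {i : ℕ | ∀ j < k, (a + 2 ^ (m + 1) * b).testBit (i + j)} =
      {i : ℕ | ∀ j < k, a.testBit (i + j)} ∪
        (· + (m + 1)) '' {i : ℕ | ∀ j < k, b.testBit (i + j)} := by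
    ext i
    simp only [Set.mem_ofPred_eq, Set.mem_union, Set.mem_image, hbit]
    constructor
    · intro h
      by_cases hi : i < m + 1
      · left
        have hik : i + k ≤ m := by
          by_contra hlt
          have := h (m - i) (by omega)
          rw [Nat.add_sub_cancel' (by omega), if_pos m.lt_succ_self, hzero m le_rfl] at this
          contradiction
        intro j hj
        simpa [show i + j < m + 1 by omega] using h j hj
      · right
        refine ⟨i - (m + 1), fun j hj => ?_, by omega⟩
        have := h j hj
        rwa [if_neg (by omega), show i + j - (m + 1) = i - (m + 1) + j by omega] at this
    · rintro (h | ⟨i, h, rfl⟩) j hj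
      · have hlt : i + j < m := by
          by_contra hle
          simpa [hzero (i + j) (by omega)] using h j hj
        rw [if_pos (by omega)]
        exact h j hj
      · rw [if_neg (by omega), show i + (m + 1) + j - (m + 1) = i + j by omega]
        exact h j hj
  have hdisj : Disjoint {i : ℕ | ∀ j < k, a.testBit (i + j)}
      ((· + (m + 1)) '' {i : ℕ | ∀ j < k, b.testBit (i + j)}) := by
    rw [Set.disjoint_left]
    rintro _ h ⟨i, -, rfl⟩
    simpa [hzero (i + (m + 1)) (by omega)] using h 0 hk
  rw [patternCount, hunion, Set.ncard_union_eq hdisj (finite_setOf_pattern hk a)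
    ((finite_setOf_pattern hk b).image _), Set.ncard_image_of_injective _ (add_left_injective _)]
  rfl

theorem patternCount_one {k : ℕ} (hk : 2 ≤ k) : patternCount k 1 = 0 := by
  have : {i : ℕ | ∀ j < k, (1 : ℕ).testBit (i + j)} = ∅ := by
    refine Set.eq_empty_of_forall_notMem fun i hi => ?_
    have := hi 1 hk
    simp [Nat.testBit_add] at this
  rw [patternCount, this, Set.ncard_empty]

theorem patternCount_add_two_pow_sq {k : ℕ} (hk : 2 ≤ k) {N i : ℕ} (hN : 4 ≤ N)
    (hi : i ^ 2 < 2 ^ N) :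
    patternCount k ((i + 2 ^ N) ^ 2) = patternCount k (i ^ 2) + patternCount k i := by
  obtain ⟨M, rfl⟩ := Nat.exists_eq_add_of_le' (le_of_add_le_right hN : 2 ≤ N)
  have hlt : i < 2 ^ M := by
    refine lt_of_pow_lt_pow_left₀ 2 (Nat.zero_le _) (hi.trans_le ?_)
    rw [← pow_mul]
    exact Nat.pow_le_pow_right two_pos (by omega)
  have hsq : (i + 2 ^ (M + 2)) ^ 2 =
      i ^ 2 + 2 ^ (M + 2 + 1) * (i + 2 ^ (M + 1) * 1) := by ring
  rw [hsq, patternCount_add_two_pow_mul (by omega) hi,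
    patternCount_add_two_pow_mul (by omega) hlt, patternCount_one hk, add_zero]

theorem patternSeq_squares_shift_eq (k : ℕ) (hk : 2 ≤ k) (ℓ : ℕ) (hℓ : 1 ≤ ℓ)
    (i : ℕ) (hi : i ^ 2 < 2 ^ (ℓ + 2 * k - 1)) :
    patternCount k ((i + 2 ^ (ℓ + 2 * k - 1)) ^ 2)
        = patternCount k (i ^ 2) + patternCount k i ∧
    patternCount k ((i + 2 ^ (ℓ + 2 * k)) ^ 2)
        = patternCount k (i ^ 2) + patternCount k i ∧
    patternSeq k ((i + 2 ^ (ℓ + 2 * k - 1)) ^ 2)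
        = patternSeq k ((i + 2 ^ (ℓ + 2 * k)) ^ 2) := by
  have h₁ := patternCount_add_two_pow_sq hk (by omega) hi
  have h₂ := patternCount_add_two_pow_sq hk (N := ℓ + 2 * k) (by omega)
    (hi.trans_le (Nat.pow_le_pow_right two_pos (Nat.sub_le _ _)))
  exact ⟨h₁, h₂, by rw [patternSeq, patternSeq, h₁, h₂]⟩
end
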